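/- arXiv:2009.02236 — 3 statements merged into one kernel-verified Lean document; each statement's English description precedes it below -/
import Mathlib

section
/- The Pauli group P is isomorphic to the central product of the cyclic group of order 4 and the dihedral group of order 8: there is a group isomorphism between P and the quotient of ZMod 4 × DihedralGroup 4 by the (central, hence normal) subgroup generated by the element ((2 : ZMod 4), DihedralGroup.r 2). -/
noncomputable def X : Matrix (Fin 2) (Fin 2) ℂ := !![0, 1; 1, 0]
noncomputable def Y : Matrix (Fin 2) (Fin 2) ℂ := !![0, -Complex.I; Complex.I, 0]
noncomputable def Z : Matrix (Fin 2) (Fin 2) ℂ := !![1, 0; 0, -1]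

theorem X_mul_X : X * X = 1 := by
  simp [X, Matrix.mul_fin_two, Matrix.one_fin_two]

theorem Y_mul_Y : Y * Y = 1 := by
  simp [Y, Matrix.mul_fin_two, Matrix.one_fin_two, Complex.I_mul_I]

theorem Z_mul_Z : Z * Z = 1 := by
  simp [Z, Matrix.mul_fin_two, Matrix.one_fin_two]

/-- The Pauli matrix `X` as a unit of the matrix ring, i.e. an element of `GL(2, ℂ)`. -/
noncomputable def Xu : (Matrix (Fin 2) (Fin 2) ℂ)ˣ := ⟨X, X, X_mul_X, X_mul_X⟩

/-- The Pauli matrix `Y` as a unit of the matrix ring, i.e. an element of `GL(2, ℂ)`. -/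
noncomputable def Yu : (Matrix (Fin 2) (Fin 2) ℂ)ˣ := ⟨Y, Y, Y_mul_Y, Y_mul_Y⟩

/-- The Pauli matrix `Z` as a unit of the matrix ring, i.e. an element of `GL(2, ℂ)`. -/
noncomputable def Zu : (Matrix (Fin 2) (Fin 2) ℂ)ˣ := ⟨Z, Z, Z_mul_Z, Z_mul_Z⟩

/-- The Pauli group: the subgroup of `GL(2, ℂ)` generated by the Pauli matrices. -/
noncomputable def P : Subgroup (Matrix (Fin 2) (Fin 2) ℂ)ˣ :=
  Subgroup.closure {Xu, Yu, Zu}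

/-- The central element `(2, r²)` of the group `ℤ/4 × D₄` (the cyclic group `ZMod 4`
written multiplicatively), generating the subgroup quotiented out in the central
product. -/
def centralElt : Multiplicative (ZMod 4) × DihedralGroup 4 :=
  (Multiplicative.ofAdd (2 : ZMod 4), DihedralGroup.r 2)

theorem centralElt_central : ∀ g : Multiplicative (ZMod 4) × DihedralGroup 4,
    g * centralElt = centralElt * g := by decide

/-- The subgroup generated by `centralElt` is central, hence normal. -/
instance : (Subgroup.zpowers centralElt).Normal := by
  constructor
  intro n hn g
  obtain ⟨k, rfl⟩ := hn
  have hc : Commute g centralElt := centralElt_central g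
  rw [(hc.zpow_right k).eq, mul_inv_cancel_right]
  exact Subgroup.zpow_mem _ (Subgroup.mem_zpowers _) k

/-- The homomorphism from the cyclic group of order `n` sending the generator to an element
`g` with `g ^ n = 1`. -/
def zmodPowHom {G : Type*} [Group G] {n : ℕ} [NeZero n] (g : G) (hg : g ^ n = 1) :
    Multiplicative (ZMod n) →* G where
  toFun i := g ^ i.toAdd.val
  map_one' := by simp
  map_mul' i j := by
    rw [toAdd_mul, ZMod.val_add, ← pow_eq_pow_mod _ hg, pow_add]

/-- The homomorphism from a dihedral group determined by a rotation `ρ` and a reflection `σ`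
satisfying the dihedral relations. -/
def dihedralHom {G : Type*} [Group G] {n : ℕ} [NeZero n] (ρ σ : G) (hρ : ρ ^ n = 1)
    (hσ : σ * σ = 1) (hσρ : ρ * σ = σ * ρ⁻¹) : DihedralGroup n →* G :=
  let φ : ZMod n → G := fun i => zmodPowHom ρ hρ (Multiplicative.ofAdd i)
  have φ_add (i j : ZMod n) : φ (i + j) = φ i * φ j := by simp [φ]
  have φ_sub (i j : ZMod n) : φ (j - i) = (φ i)⁻¹ * φ j := by
    rw [eq_inv_mul_iff_mul_eq, ← φ_add, add_sub_cancel]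
  have φ_mul (i : ZMod n) : φ i * σ = σ * (φ i)⁻¹ := by
    have h : SemiconjBy σ ρ⁻¹ ρ := hσρ.symm
    have := (h.pow_right i.val).eq
    rw [inv_pow] at this
    exact this.symm
  { toFun := fun
      | .r i => φ i
      | .sr i => σ * φ i
    map_one' := map_one (zmodPowHom ρ hρ)
    map_mul' := by
      rintro (i | i) (j | j)
      · exact φ_add i j
      · change σ * φ (j - i) = φ i * (σ * φ j)
        rw [φ_sub, ← mul_assoc, ← mul_assoc, φ_mul]
      · change σ * φ (i + j) = σ * φ i * φ j
        rw [φ_add, mul_assoc]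
      · change φ (j - i) = σ * φ i * (σ * φ j)
        rw [φ_sub, mul_assoc, ← mul_assoc (φ i), φ_mul, ← mul_assoc, ← mul_assoc, hσ,
          one_mul] }

theorem coe_XYZ :
    (↑(Xu * Yu * Zu) : Matrix (Fin 2) (Fin 2) ℂ) = !![Complex.I, 0; 0, Complex.I] := by
  simp [Xu, Yu, Zu, X, Y, Z]

theorem coe_ZX : (↑(Zu * Xu) : Matrix (Fin 2) (Fin 2) ℂ) = !![0, 1; -1, 0] := by
  simp [Xu, Zu, X, Z]

theorem XYZ_commute (g : (Matrix (Fin 2) (Fin 2) ℂ)ˣ) : Commute (Xu * Yu * Zu) g := by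
  refine Units.ext ?_
  rw [Units.val_mul, Units.val_mul _ (_ * _), coe_XYZ]
  ext i j
  fin_cases i <;> fin_cases j <;> simp [Matrix.mul_apply, Fin.sum_univ_two, mul_comm]

theorem XYZ_sq : (Xu * Yu * Zu) ^ 2 = -1 := by
  refine Units.ext ?_
  rw [Units.val_pow_eq_pow_val, coe_XYZ]
  simp [sq, Matrix.one_fin_two]

theorem ZX_sq : (Zu * Xu) ^ 2 = -1 := by
  refine Units.ext ?_
  rw [Units.val_pow_eq_pow_val, coe_ZX]
  simp [sq, Matrix.one_fin_two]

theorem Xu_mul_Xu : Xu * Xu = 1 := Units.ext X_mul_X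
theorem Zu_mul_Zu : Zu * Zu = 1 := Units.ext Z_mul_Z

theorem XYZ_pow_four : (Xu * Yu * Zu) ^ 4 = 1 := by
  rw [show 4 = 2 * 2 from rfl, pow_mul, XYZ_sq, neg_one_sq]

theorem ZX_pow_four : (Zu * Xu) ^ 4 = 1 := by
  rw [show 4 = 2 * 2 from rfl, pow_mul, ZX_sq, neg_one_sq]

theorem ZX_mul_Xu : Zu * Xu * Xu = Xu * (Zu * Xu)⁻¹ := by
  rw [eq_mul_inv_iff_mul_eq, mul_assoc Zu, Xu_mul_Xu, mul_one, ← mul_assoc, Zu_mul_Zu, one_mul]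

/-- The homomorphism `ℤ/4 × D₄ → GL(2, ℂ)` sending `(1, 1)` to `XYZ = i`, `(0, r 1)` to `ZX`
and `(0, sr 0)` to `X`. -/
noncomputable def pauliHom :
    Multiplicative (ZMod 4) × DihedralGroup 4 →* (Matrix (Fin 2) (Fin 2) ℂ)ˣ :=
  (zmodPowHom _ XYZ_pow_four).noncommCoprod
    (dihedralHom _ _ ZX_pow_four Xu_mul_Xu ZX_mul_Xu)
    fun _ _ => (XYZ_commute _).pow_left _

theorem pauliHom_r (a i : ZMod 4) : pauliHom (Multiplicative.ofAdd a, .r i) =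
    (Xu * Yu * Zu) ^ a.val * (Zu * Xu) ^ i.val := rfl

theorem pauliHom_sr (a i : ZMod 4) : pauliHom (Multiplicative.ofAdd a, .sr i) =
    (Xu * Yu * Zu) ^ a.val * (Xu * (Zu * Xu) ^ i.val) := rfl

theorem pauliHom_range : pauliHom.range = P := by
  have hX : Xu ∈ P := Subgroup.subset_closure (by simp)
  have hY : Yu ∈ P := Subgroup.subset_closure (by simp)
  have hZ : Zu ∈ P := Subgroup.subset_closure (by simp)
  have hc := mul_mem (mul_mem hX hY) hZ
  have hr := mul_mem hZ hX
  apply le_antisymm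
  · rintro _ ⟨⟨a, i | i⟩, rfl⟩
    · exact mul_mem (pow_mem hc _) (pow_mem hr _)
    · exact mul_mem (pow_mem hc _) (mul_mem hX (pow_mem hr _))
  · have hX' : Xu ∈ pauliHom.range := 
      ⟨(Multiplicative.ofAdd 0, .sr 0), by rw [pauliHom_sr]; simp⟩
    have hr' : Zu * Xu ∈ pauliHom.range :=
      ⟨(Multiplicative.ofAdd 0, .r 1), by rw [pauliHom_r]; simp [ZMod.val_one'']⟩
    have hc' : Xu * Yu * Zu ∈ pauliHom.range :=
      ⟨(Multiplicative.ofAdd 1, .r 0), by rw [pauliHom_r]; simp [ZMod.val_one'']⟩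
    have hZ' : Zu ∈ pauliHom.range := (Subgroup.mul_mem_cancel_right _ hX').1 hr'
    have hY' : Yu ∈ pauliHom.range :=
      (Subgroup.mul_mem_cancel_left _ hX').1 ((Subgroup.mul_mem_cancel_right _ hZ').1 hc')
    rw [P, Subgroup.closure_le]
    rintro _ (rfl | rfl | rfl) <;> assumption

theorem pauliHom_ker : pauliHom.ker = Subgroup.zpowers centralElt := by
  apply le_antisymm
  · rintro ⟨a, i | i⟩ h
    · obtain ⟨a, rfl⟩ := Multiplicative.ofAdd.surjective a
      suffices (a = 0 ∧ i = 0) ∨ (a = 2 ∧ i = 2) by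
        rcases this with ⟨rfl, rfl⟩ | ⟨rfl, rfl⟩
        · exact one_mem _
        · exact Subgroup.mem_zpowers _
      rw [MonoidHom.mem_ker, pauliHom_r, Units.ext_iff, Units.val_mul, Units.val_pow_eq_pow_val,
        Units.val_pow_eq_pow_val, coe_XYZ, coe_ZX] at h
      have h0 := congrFun₂ h 0 0
      have h1 := congrFun₂ h 0 1
      clear h
      revert h0 h1
      fin_cases a <;> fin_cases i <;>
        norm_num [ZMod.val, pow_succ, Matrix.one_fin_two, Complex.ext_iff] <;>
        first | exact .inl rfl | exact .inr rfl
    · exfalso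
      obtain ⟨a, rfl⟩ := Multiplicative.ofAdd.surjective a
      rw [MonoidHom.mem_ker, pauliHom_sr, Units.ext_iff, Units.val_mul, Units.val_mul,
        Units.val_pow_eq_pow_val, Units.val_pow_eq_pow_val, coe_XYZ, coe_ZX] at h
      have h0 := congrFun₂ h 0 0
      have h1 := congrFun₂ h 1 1
      clear h
      revert h0 h1
      fin_cases a <;> fin_cases i <;>
        norm_num [ZMod.val, Xu, X, pow_succ, Matrix.one_fin_two, Complex.ext_iff]
  · rw [Subgroup.zpowers_le, MonoidHom.mem_ker, centralElt, pauliHom_r]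
    exact (congrArg₂ (· * ·) XYZ_sq ZX_sq).trans (by simp)

/-- The Pauli group is the central product of the cyclic group of order 4 and the
dihedral group `D₄` of order 8: it is isomorphic to the quotient of `ℤ/4 × D₄` by the
central subgroup generated by the element `(2, r²)`. -/
theorem pauli_group_central_product :
    Nonempty (P ≃* ((Multiplicative (ZMod 4) × DihedralGroup 4) ⧸
      Subgroup.zpowers centralElt)) := by
  exact ⟨(MulEquiv.subgroupCongr pauliHom_range.symm).trans
    ((QuotientGroup.quotientKerEquivRange pauliHom).symm.trans
      (QuotientGroup.quotientMulEquivOfEq pauliHom_ker))⟩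
end

section
/- The shortest word in the kernel of the map from ℤ/3 * ℤ/2 to U = ⟨S, X⟩ has length 12. Concretely: let S be any invertible 2×2 complex matrix with S^3 = 1, S * X * S⁻¹ = Y, and S * Y * S⁻¹ = Z. Then (a) for every k with 1 ≤ k ≤ 5 and every ε : Fin k → ({1, 2} : Set ℕ), the product ∏_{i=0}^{k-1} (S^(ε i) * X) is not equal to the identity matrix; and (b) there exists ε : Fin 6 → ({1, 2} : Set ℕ) such that ∏_{i=0}^{5} (S^(ε i) * X) equals the identity matrix. -/
open Complex Matrix in
/-- A matrix of order three conjugating `X ↦ Y ↦ Z` is determined up to a cube root of unity. -/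
theorem exists_eq_of_conj_pauli (S : Matrix (Fin 2) (Fin 2) ℂ) (hS : IsUnit S) (hS3 : S ^ 3 = 1)
    (hSX : S * X * S⁻¹ = Y) (hSY : S * Y * S⁻¹ = Z) :
    ∃ b : ℂ, 4 * b ^ 3 = I - 1 ∧ S = !![I * b, b; I * b, -b] := by
  have hdet : IsUnit S.det := (isUnit_iff_isUnit_det S).1 hS
  have intertwine {A B : Matrix (Fin 2) (Fin 2) ℂ} (h : S * A * S⁻¹ = B) : S * A = B * S := by
    rw [← h, nonsing_inv_mul_cancel_right _ _ hdet]
  have hX := intertwine hSX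
  have hY := intertwine hSY
  have hI := I_mul_I
  obtain ⟨a, b, c, d, rfl⟩ : ∃ a b c d, S = !![a, b; c, d] := ⟨_, _, _, _, eta_fin_two S⟩
  simp only [X, Y, Z, mul_fin_two, EmbeddingLike.apply_eq_iff_eq, vecCons_inj, and_true] at hX hY
  have ha : a = I * b := by grind
  have hc : c = I * b := by grind
  have hd : d = -b := by grind
  subst ha hc hd
  refine ⟨b, ?_, rfl⟩
  simp only [pow_succ, pow_zero, one_mul, mul_fin_two, one_fin_two,
    EmbeddingLike.apply_eq_iff_eq, vecCons_inj, and_true] at hS3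
  grind

/-- If `S ^ 3 = 1`, an alternating product in `S` and `X` equal to `1` has an even number of
factors `X`, since `det X = -1`. -/
theorem even_of_prod_eq_one (S : Matrix (Fin 2) (Fin 2) ℂ) (hS3 : S ^ 3 = 1) (k : ℕ)
    (ε : Fin k → ℕ) (h : (List.ofFn fun i => S ^ ε i * X).prod = 1) : Even k := by
  have hX : X.det = -1 := by simp [X]
  have hdet : S.det ^ 3 = 1 := by rw [← Matrix.det_pow, hS3, Matrix.det_one]
  have hcube (n : ℕ) : (S.det ^ n * -1) ^ 3 = -1 := by
    rw [mul_pow, ← pow_mul, mul_comm n, pow_mul, hdet]; norm_num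
  have h' := congrArg (fun A => Matrix.detMonoidHom A ^ 3) h
  simp only [map_list_prod, List.map_ofFn, List.prod_ofFn, Function.comp_def, map_one, one_pow,
    Matrix.coe_detMonoidHom, Matrix.det_mul, Matrix.det_pow, hX, ← Finset.prod_pow, hcube,
    Finset.prod_const, Finset.card_univ, Fintype.card_fin] at h'
  exact (neg_one_pow_eq_one_iff_even (by norm_num)).1 h'

/-- The shortest word in the kernel of the natural map `ℤ/3 * ℤ/2 → U = ⟨S, X⟩` has
length 12: for any invertible `S` of order dividing 3 conjugating `X ↦ Y ↦ Z`, no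
alternating product `S^(ε 0) * X * ⋯ * S^(ε (k-1)) * X` with `ε i ∈ {1, 2}` and
`1 ≤ k ≤ 5` is the identity, while some such product with `k = 6` is. -/
theorem shortest_kernel_word_length_twelve
    (S : Matrix (Fin 2) (Fin 2) ℂ) (hS : IsUnit S) (hS3 : S ^ 3 = 1)
    (hSX : S * X * S⁻¹ = Y) (hSY : S * Y * S⁻¹ = Z) :
    (∀ k : ℕ, 1 ≤ k → k ≤ 5 → ∀ ε : Fin k → ({1, 2} : Set ℕ),
      (List.ofFn fun i : Fin k => S ^ (ε i : ℕ) * X).prod ≠ 1) ∧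
    (∃ ε : Fin 6 → ({1, 2} : Set ℕ),
      (List.ofFn fun i : Fin 6 => S ^ (ε i : ℕ) * X).prod = 1) := by
  obtain ⟨b, hb, hSb⟩ := exists_eq_of_conj_pauli S hS hS3 hSX hSY
  have hI := Complex.I_mul_I
  have hb0 : b ≠ 0 := by
    rintro rfl
    have := congrArg Complex.im hb
    simp at this
  have h1 : S ^ 1 * X = !![b, Complex.I * b; -b, Complex.I * b] := by
    simp [hSb, X]
  have h2 : S ^ 2 * X = !![(Complex.I - 1) * b ^ 2, (Complex.I - 1) * b ^ 2;
      (Complex.I + 1) * b ^ 2, -(Complex.I + 1) * b ^ 2] := by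
    rw [hSb, pow_two, X, Matrix.mul_fin_two, Matrix.mul_fin_two]
    simp only [EmbeddingLike.apply_eq_iff_eq, Matrix.vecCons_inj, and_true]
    grind
  constructor
  · intro k hk1 hk5 ε h
    have hk := even_of_prod_eq_one S hS3 k (fun i => ε i) h
    have hε (i : Fin k) : S ^ (ε i : ℕ) * X = S ^ 1 * X ∨ S ^ (ε i : ℕ) * X = S ^ 2 * X := by
      rcases (ε i).2 with h | h
      · exact .inl (by rw [h])
      · exact .inr (by rw [Set.mem_singleton_iff.1 h])
    obtain rfl | rfl : k = 2 ∨ k = 4 := by grind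
    · simp only [List.ofFn_succ, List.ofFn_zero, List.prod_cons, List.prod_nil, mul_one] at h
      rcases hε 0 with e0 | e0 <;> rcases hε 1 with e1 | e1 <;>
      · simp only [Fin.succ_zero_eq_one, e0, e1, h1, h2, Matrix.mul_fin_two, Matrix.one_fin_two,
          EmbeddingLike.apply_eq_iff_eq, Matrix.vecCons_inj, and_true] at h
        grind
    · simp only [List.ofFn_succ, List.ofFn_zero, List.prod_cons, List.prod_nil, mul_one] at h
      rcases hε 0 with e0 | e0 <;> rcases hε 1 with e1 | e1 <;>
      rcases hε 2 with e2 | e2 <;> rcases hε 3 with e3 | e3 <;>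
      · simp only [Fin.succ_zero_eq_one, Fin.succ_one_eq_two, show (2 : Fin 3).succ = 3 from rfl,
          e0, e1, e2, e3, h1, h2, Matrix.mul_fin_two, Matrix.one_fin_two,
          EmbeddingLike.apply_eq_iff_eq, Matrix.vecCons_inj, and_true] at h
        grind
  · refine ⟨![⟨1, by simp⟩, ⟨1, by simp⟩, ⟨1, by simp⟩, ⟨2, by simp⟩, ⟨2, by simp⟩,
      ⟨2, by simp⟩], ?_⟩
    have h111 : S ^ 1 * X * (S ^ 1 * X * (S ^ 1 * X)) = !![Complex.I, 0; 0, Complex.I] := by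
      rw [h1, Matrix.mul_fin_two, Matrix.mul_fin_two]
      simp only [EmbeddingLike.apply_eq_iff_eq, Matrix.vecCons_inj, and_true]
      grind
    have h222 : S ^ 2 * X * (S ^ 2 * X * (S ^ 2 * X)) = !![-Complex.I, 0; 0, -Complex.I] := by
      rw [h2, Matrix.mul_fin_two, Matrix.mul_fin_two]
      simp only [EmbeddingLike.apply_eq_iff_eq, Matrix.vecCons_inj, and_true]
      grind
    have key : S ^ 1 * X * (S ^ 1 * X * (S ^ 1 * X)) *
        (S ^ 2 * X * (S ^ 2 * X * (S ^ 2 * X))) = 1 := by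
      rw [h111, h222, Matrix.mul_fin_two, Matrix.one_fin_two]
      simp
    simpa [List.ofFn_succ, Matrix.mul_assoc] using key
end

section
/- There exists a doubly periodic Pauli puzzle: there is a labeling f : ℤ × ℤ × Bool → Fin 3 satisfying conditions (1) and (2) of a Pauli puzzle which moreover satisfies f(x+3, y, b) = f(x, y, b) and f(x, y+1, b) = f(x, y, b) for all x, y ∈ ℤ and b : Bool. (In particular, Pauli puzzles invariant under a rank-2 group of translations exist.) -/
/-- The labeling of the Pauli matrices by the alphabet `Fin 3`. -/
noncomputable def σ : Fin 3 → Matrix (Fin 2) (Fin 2) ℂ := ![X, Y, Z]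

/-- The labeling that advances cyclically through the Pauli matrices in the direction of the first
basis vector and is constant along the second one. -/
def cyclicPuzzle (t : ℤ × ℤ × Bool) : ZMod 3 :=
  (t.1 : ZMod 3) + if t.2.2 then 2 else 0

/-- The product of the Pauli matrices around a vertex of `cyclicPuzzle` is the identity. -/
theorem pauli_cyclic_product (a : Fin 3) :
    σ a * σ (a + 1) * σ (a + 2) * σ (a + 1) * σ a * σ (a + 2) = 1 := by
  fin_cases a <;> ext i j <;> fin_cases i <;> fin_cases j <;>
    simp [σ, X, Y, Z, Matrix.mul_apply, Fin.sum_univ_two]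

/-- There exists a doubly periodic Pauli puzzle: a labeling of the triangles of the
standard triangular tiling of the plane by Pauli matrices such that (1) edge-adjacent
triangles have distinct labels, (2) the cyclic product of the Pauli matrices on the
six triangles around every vertex is the identity, which is invariant under the
rank-2 translation group generated by `(3, 0)` and `(0, 1)`.
Here `(x, y, false)` denotes the upward triangle with vertices `(x,y)`, `(x+1,y)`,
`(x,y+1)` and `(x, y, true)` the downward triangle with vertices `(x+1,y)`, `(x,y+1)`,
`(x+1,y+1)` of the triangular lattice. -/
theorem exists_doubly_periodic_pauli_puzzle :
    ∃ f : ℤ × ℤ × Bool → Fin 3,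
      (∀ x y : ℤ,
        f (x, y, false) ≠ f (x, y, true) ∧
        f (x, y, true) ≠ f (x + 1, y, false) ∧
        f (x, y, true) ≠ f (x, y + 1, false)) ∧
      (∀ x y : ℤ,
        σ (f (x, y, false)) * σ (f (x - 1, y, true)) * σ (f (x - 1, y, false)) *
          σ (f (x - 1, y - 1, true)) * σ (f (x, y - 1, false)) * σ (f (x, y - 1, true))
          = 1) ∧
      (∀ (x y : ℤ) (b : Bool), f (x + 3, y, b) = f (x, y, b)) ∧
      (∀ (x y : ℤ) (b : Bool), f (x, y + 1, b) = f (x, y, b)) := by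
  have labels_ne (a : ZMod 3) : a ≠ a + 2 ∧ a + 2 ≠ a + 1 ∧ a + 2 ≠ a := by
    revert a; decide
  have sub_one_eq (a : ZMod 3) : a - 1 = a + 2 := by revert a; decide
  have add_three_eq (a : ZMod 3) : a + 3 = a := by revert a; decide
  have up (x y : ℤ) : cyclicPuzzle (x, y, false) = (x : ZMod 3) := by simp [cyclicPuzzle]
  have down (x y : ℤ) : cyclicPuzzle (x, y, true) = (x : ZMod 3) + 2 := by simp [cyclicPuzzle]
  have up_succ (x y : ℤ) : cyclicPuzzle (x + 1, y, false) = (x : ZMod 3) + 1 := by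
    simp [cyclicPuzzle]
  have up_pred (x y : ℤ) : cyclicPuzzle (x - 1, y, false) = (x : ZMod 3) + 2 := by
    simp [cyclicPuzzle, sub_one_eq]
  have down_pred (x y : ℤ) : cyclicPuzzle (x - 1, y, true) = (x : ZMod 3) + 1 := by
    rw [down]; push_cast; ring
  have period (x y : ℤ) (b : Bool) : cyclicPuzzle (x + 3, y, b) = cyclicPuzzle (x, y, b) := by
    simp only [cyclicPuzzle, Int.cast_add, Int.cast_ofNat, add_three_eq]
  refine ⟨cyclicPuzzle, fun x y => ?_, fun x y => ?_, period, fun x y b => rfl⟩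
  · rw [up, down, up_succ, up]
    exact labels_ne x
  · rw [up, down_pred, up_pred, down_pred, up, down]
    exact pauli_cyclic_product (x : ZMod 3)
end
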